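/- The oik-sum of oiks is an oik: if 𝓡_p is a d_p-oik on V for p ∈ [h] and m = Σ d_p, then the collection of sets R₁ ⊎ ⋯ ⊎ R_h ⊆ [h]×V with R_p ∈ 𝓡_p is an m-dimensional Euler complex on [h]×V. -/

import Mathlib

open scoped Classical

/-- A d-dimensional Euler complex (d-oik) on V: a multiset of d-element
subsets of V (rooms) such that every (d−1)-element subset of V is contained
in an even number of rooms. -/
def IsOik (V : Type*) [DecidableEq V] (d : ℕ) (R : Multiset (Finset V)) : Prop :=
  (∀ r ∈ R, r.card = d) ∧
  ∀ W : Finset V, W.card = d - 1 → Even (R.countP fun r => W ⊆ r)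

noncomputable def oikFib {V : Type*} [DecidableEq V] {h : ℕ} (T : Finset (Fin h × V)) (p : Fin h) :
    Finset V := (T.filter fun x => x.1 = p).image Prod.snd

noncomputable def oikAsm {V : Type*} [DecidableEq V] {h : ℕ} (x : Fin h → Finset V) :
    Finset (Fin h × V) := Finset.univ.biUnion fun p => (x p).image (Prod.mk p)

theorem mem_oikFib {V : Type*} [DecidableEq V] {h : ℕ} (T : Finset (Fin h × V)) (p : Fin h) (v : V) :
    v ∈ oikFib T p ↔ (p, v) ∈ T := by
  simp [oikFib]

theorem mem_oikAsm {V : Type*} [DecidableEq V] {h : ℕ} (x : Fin h → Finset V) (p : Fin h) (v : V) :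
    (p, v) ∈ oikAsm x ↔ v ∈ x p := by
  simp [oikAsm]

theorem card_oikFib {V : Type*} [DecidableEq V] {h : ℕ} (T : Finset (Fin h × V)) :
    T.card = ∑ p, (oikFib T p).card := by
  rw [Finset.card_eq_sum_card_fiberwise (f := Prod.fst) (t := Finset.univ) (by simp)]
  refine Finset.sum_congr rfl fun p _ => ?_
  unfold oikFib
  rw [Finset.card_image_of_injOn]
  rintro ⟨a, b⟩ ha ⟨c, e⟩ hc hbe
  simp at ha hc hbe
  simp [ha.2, hc.2, hbe]

theorem countP_eq_oik {α : Type*} [DecidableEq α] (S : Multiset α) (P : α → Prop)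
    [DecidablePred P] : S.countP P = ∑ T ∈ S.toFinset.filter P, S.count T := by
  rw [Multiset.countP_eq_card_filter, ← Multiset.toFinset_sum_count_eq, Multiset.toFinset_filter]
  refine Finset.sum_congr rfl fun T hT => ?_
  rw [Multiset.count_filter_of_pos (Finset.mem_filter.1 hT).2]

theorem oik_countP {V : Type*} [DecidableEq V] (h : ℕ)
    (R : Fin h → Multiset (Finset V))
    (S : Multiset (Finset (Fin h × V)))
    (hS : ∀ T : Finset (Fin h × V), S.count T = ∏ p, (R p).count (oikFib T p))
    (W : Finset (Fin h × V)) :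
    (S.countP fun r => W ⊆ r) = ∏ p, (R p).countP fun r => oikFib W p ⊆ r := by
  have hfa : ∀ x : Fin h → Finset V, oikFib (oikAsm x) = x := by
    intro x; ext p v; rw [mem_oikFib, mem_oikAsm]
  have haf : ∀ T : Finset (Fin h × V), oikAsm (oikFib T) = T := by
    intro x; ext ⟨p, v⟩; rw [mem_oikAsm, mem_oikFib]
  have hsub : ∀ T : Finset (Fin h × V), W ⊆ T ↔ ∀ p, oikFib W p ⊆ oikFib T p := by
    intro T
    constructor
    · intro hT p v hv
      rw [mem_oikFib] at *
      exact hT hv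
    · rintro hT ⟨p, v⟩ hv
      have := hT p ((mem_oikFib W p v).2 hv)
      rwa [mem_oikFib] at this
  have hmem : ∀ T, T ∈ S ↔ ∀ p, oikFib T p ∈ R p := by
    intro T
    rw [← Multiset.count_ne_zero, hS, Finset.prod_ne_zero_iff]
    simp [Multiset.count_ne_zero]
  rw [countP_eq_oik]
  simp_rw [countP_eq_oik]
  rw [Finset.prod_univ_sum]
  refine Finset.sum_bij' (fun T _ => oikFib T) (fun x _ => oikAsm x) ?_ ?_ ?_ ?_ ?_
  · intro T hT
    simp only [Finset.mem_filter, Multiset.mem_toFinset, Fintype.mem_piFinset] at *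
    exact fun p => ⟨(hmem T).1 hT.1 p, (hsub T).1 hT.2 p⟩
  · intro x hx
    simp only [Finset.mem_filter, Multiset.mem_toFinset, Fintype.mem_piFinset] at *
    rw [hmem, hsub, hfa]
    exact ⟨fun p => (hx p).1, fun p => (hx p).2⟩
  · intro T _; exact haf T
  · intro x _; exact hfa x
  · intro T _
    exact hS T

/-- The oik-sum of oiks is an oik: if 𝓡_p is a d_p-oik on V for p ∈ [h] and
m = Σ d_p, then the multiset of sets R₁ ⊎ ⋯ ⊎ R_h ⊆ [h]×V with R_p ∈ 𝓡_p
(each room of the sum occurring with multiplicity the product of the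
multiplicities of its fibers R_p = {v : (p,v) ∈ T} in the respective oiks)
is an m-dimensional Euler complex on [h]×V. -/
theorem stmt_14 {V : Type*} [DecidableEq V] (h : ℕ) (hh : 0 < h)
    (d : Fin h → ℕ) (hd : ∀ p, 2 ≤ d p)
    (𝓡 : Fin h → Multiset (Finset V))
    (hoik : ∀ p, IsOik V (d p) (𝓡 p))
    (S : Multiset (Finset (Fin h × V)))
    (hS : ∀ T : Finset (Fin h × V),
      S.count T = ∏ p, (𝓡 p).count ((T.filter fun x => x.1 = p).image Prod.snd)) :
    IsOik (Fin h × V) (∑ p, d p) S := by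
  have hS' : ∀ T : Finset (Fin h × V), S.count T = ∏ p, (𝓡 p).count (oikFib T p) := by
    intro T
    convert hS T using 3
    unfold oikFib
    congr!
  have hmem : ∀ T, T ∈ S → ∀ p, oikFib T p ∈ 𝓡 p := by
    intro T hT p
    rw [← Multiset.count_ne_zero, hS', Finset.prod_ne_zero_iff] at hT
    exact Multiset.count_ne_zero.1 (hT p (Finset.mem_univ p))
  refine ⟨?_, ?_⟩
  · intro T hT
    rw [card_oikFib]
    exact Finset.sum_congr rfl fun p _ => (hoik p).1 _ (hmem T hT p)
  · intro W hW
    have key : Even (∏ p, (𝓡 p).countP fun r => oikFib W p ⊆ r) := by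
      by_cases h1 : ∃ p, (oikFib W p).card = d p - 1
      · obtain ⟨p, hp⟩ := h1
        have := (hoik p).2 _ hp
        have h2 : Even ((𝓡 p).countP fun r => oikFib W p ⊆ r) := by convert this
        exact even_iff_two_dvd.2 ((even_iff_two_dvd.1 h2).trans
          (Finset.dvd_prod_of_mem _ (Finset.mem_univ p)))
      · push Not at h1
        have h3 : ∃ p, d p < (oikFib W p).card := by
          by_contra h4
          push Not at h4
          rw [card_oikFib] at hW
          have hpos : 2 ≤ ∑ p, d p :=
            (hd ⟨0, hh⟩).trans (Finset.single_le_sum (f := d) (fun _ _ => Nat.zero_le _)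
              (Finset.mem_univ _))
          by_cases h5 : ∀ p, (oikFib W p).card = d p
          · have h6 : ∑ p, (oikFib W p).card = ∑ p, d p := Finset.sum_congr rfl fun p _ => h5 p
            omega
          · push Not at h5
            obtain ⟨p, hp⟩ := h5
            have a := Finset.add_sum_erase Finset.univ d (Finset.mem_univ p)
            have b := Finset.add_sum_erase Finset.univ (fun p => (oikFib W p).card)
              (Finset.mem_univ p)
            have c : ∑ q ∈ Finset.univ.erase p, (oikFib W q).card
                ≤ ∑ q ∈ Finset.univ.erase p, d q := Finset.sum_le_sum fun q _ => h4 q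
            have := h1 p
            have := h4 p
            have := hd p
            omega
        obtain ⟨p, hp⟩ := h3
        rw [Finset.prod_eq_zero (Finset.mem_univ p)]
        · exact Even.zero
        · rw [Multiset.countP_eq_zero]
          intro r hr hsub
          have := Finset.card_le_card hsub
          rw [(hoik p).1 r hr] at this
          omega
    rw [← oik_countP h 𝓡 S (by intro T; convert hS' T) W] at key
    convert key
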